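/- Let n ≥ 1, let f = (f_1,…,f_n) ∈ 𝓑_c^n, let V ⊆ ℝ^n be nonempty and closed, and let X ∈ 𝒯^d(f). Then there exists a random vector Y ∈ 𝒯^d(f) such that P(X ∈ V) = P(Y ∈ ∂_SW Q(V)), where Q(V) ⊆ [0,∞)^n denotes the image of V under Q. -/

import Mathlib

open MeasureTheory Filter Set

noncomputable section

/-- The southwest boundary of a set `V ⊆ [0,∞)^n`: the set of minimal elements of `V`
under the componentwise order. -/
def swBoundary {n : ℕ} (V : Set (Fin n → ℝ)) : Set (Fin n → ℝ) :=
  {x | x ∈ V ∧ ∀ y ∈ V, y ≤ x → y = x}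

/-- The reflection map `Q(x₁,…,xₙ) = (|x₁|,…,|xₙ|)`. -/
def Qmap {n : ℕ} (x : Fin n → ℝ) : Fin n → ℝ := fun i => |x i|

theorem isProperMap_abs : IsProperMap (abs : ℝ → ℝ) := by
  refine isProperMap_iff_tendsto_cocompact.2 ⟨continuous_abs, ?_⟩
  rw [← Metric.cobounded_eq_cocompact, ← tendsto_norm_atTop_iff_cobounded]
  simp only [Real.norm_eq_abs, abs_abs]
  exact tendsto_norm_cobounded_atTop (E := ℝ)

theorem isClosedMap_Qmap {n : ℕ} : IsClosedMap (Qmap (n := n)) :=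
  (IsProperMap.pi_map fun _ : Fin n => isProperMap_abs).isClosedMap

theorem measurable_Qmap {n : ℕ} : Measurable (Qmap (n := n)) :=
  measurable_pi_lambda _ fun i => (measurable_pi_apply i).abs

theorem Qmap_nonneg {n : ℕ} (x : Fin n → ℝ) : 0 ≤ Qmap x := fun _ => abs_nonneg _

section Retraction

variable {n : ℕ} {W : Set (Fin n → ℝ)}

/-- Lowering one coordinate of `x` to its least value among the points of `W` below `x` is a
measurable operation. -/
theorem exists_measurable_lower_coordinate (hW : IsClosed W) (hW0 : ∀ x ∈ W, 0 ≤ x) (i : Fin n) :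
    ∃ S : (Fin n → ℝ) → Fin n → ℝ, Measurable S ∧ ∀ x ∈ upperClosure W,
      S x ≤ x ∧ S x ∈ upperClosure W ∧ ∀ y ∈ W, y ≤ x → S x i ≤ y i := by
  classical
  have hleast : ∀ x ∈ upperClosure W, ∃ m, IsLeast ((fun y => y i) '' (W ∩ Iic x)) m := by
    rintro x ⟨y, hy, hyx⟩
    have hc : IsCompact (W ∩ Iic x) := by
      refine (isCompact_Icc (a := (0 : Fin n → ℝ)) (b := x)).of_isClosed_subset
        (hW.inter isClosed_Iic) fun z hz => ⟨hW0 z hz.1, hz.2⟩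
    exact (hc.image (continuous_apply i)).exists_isLeast ⟨y i, y, ⟨hy, hyx⟩, rfl⟩
  choose! m hm using hleast
  have hclosed : ∀ s : Set (Fin n → ℝ), IsClosed s → s ⊆ W →
      IsClosed (upperClosure s : Set (Fin n → ℝ)) := fun s hs hsW =>
    hs.upperClosure_pi ⟨0, fun x hx => hW0 x (hsW hx)⟩
  have hF := (hclosed W hW subset_rfl).measurableSet
  let g : (Fin n → ℝ) → ℝ := fun x => if x ∈ upperClosure W then m x else x i
  have hg : Measurable g := by
    refine measurable_of_Iic fun q => ?_
    have hC := (hclosed (W ∩ {y | y i ≤ q})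
      (hW.inter (isClosed_le (continuous_apply i) continuous_const)) inter_subset_left).measurableSet
    have hq : MeasurableSet {x : Fin n → ℝ | x i ≤ q} :=
      measurableSet_le (measurable_pi_apply i) measurable_const
    convert (hF.inter hC).union (hF.compl.inter hq) using 1
    ext x
    by_cases hx : x ∈ upperClosure W
    · have hiff : m x ≤ q ↔ x ∈ upperClosure (W ∩ {y | y i ≤ q}) := by
        constructor
        · intro h
          obtain ⟨y, ⟨hyW, hyx⟩, hy⟩ := (hm x hx).1
          exact ⟨y, ⟨hyW, (le_of_eq hy).trans h⟩, hyx⟩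
        · rintro ⟨y, ⟨hyW, hyq⟩, hyx⟩
          exact ((hm x hx).2 ⟨y, ⟨hyW, hyx⟩, rfl⟩).trans hyq
      simp only [g, mem_preimage, mem_Iic, mem_union, mem_inter_iff, mem_compl_iff,
        SetLike.mem_coe, hx, hiff, not_true_eq_false, true_and, false_and, or_false, if_true]
    · simp only [g, mem_preimage, mem_Iic, mem_union, mem_inter_iff, mem_compl_iff,
        SetLike.mem_coe, hx, not_false_eq_true, true_and, false_and, false_or, mem_ofPred_eq,
        if_false]
  refine ⟨fun x => Function.update x i (g x), ?_, fun x hx => ?_⟩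
  · refine measurable_pi_lambda _ fun j => ?_
    by_cases hj : j = i
    · subst hj
      simpa using hg
    · simpa [hj] using measurable_pi_apply j
  · have hgx : g x = m x := if_pos hx
    obtain ⟨y, ⟨hyW, hyx⟩, hy⟩ := (hm x hx).1
    have hy : y i = m x := hy
    refine ⟨update_le_iff.2 ⟨?_, fun _ _ => le_rfl⟩,
      ⟨y, hyW, le_update_iff.2 ⟨?_, fun j _ => hyx j⟩⟩, fun z hz hzx => ?_⟩
    · rw [hgx, ← hy]
      exact hyx i
    · rw [hgx, hy]
    · simpa [hgx] using (hm x hx).2 ⟨z, ⟨hz, hzx⟩, rfl⟩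

theorem exists_measurable_lower_coordinates (hW : IsClosed W) (hW0 : ∀ x ∈ W, 0 ≤ x)
    (l : List (Fin n)) :
    ∃ T : (Fin n → ℝ) → Fin n → ℝ, Measurable T ∧ ∀ x ∈ upperClosure W,
      T x ≤ x ∧ T x ∈ upperClosure W ∧ ∀ i ∈ l, ∀ y ∈ W, y ≤ T x → T x i ≤ y i := by
  induction l with
  | nil => exact ⟨id, measurable_id, fun x hx => ⟨le_rfl, hx, by simp⟩⟩
  | cons i l ih =>
    obtain ⟨T, hT, hTx⟩ := ih
    obtain ⟨S, hS, hSx⟩ := exists_measurable_lower_coordinate hW hW0 i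
    refine ⟨S ∘ T, hS.comp hT, fun x hx => ?_⟩
    obtain ⟨hle, hmem, hmin⟩ := hTx x hx
    obtain ⟨hle', hmem', hmin'⟩ := hSx (T x) hmem
    refine ⟨hle'.trans hle, hmem', fun j hj y hy hyx => ?_⟩
    rcases List.mem_cons.1 hj with rfl | hj
    · exact hmin' y hy (hyx.trans hle')
    · exact (hle' j).trans (hmin j hj y hy (hyx.trans hle'))

theorem exists_measurable_retraction_swBoundary (hW : IsClosed W) (hW0 : ∀ x ∈ W, 0 ≤ x) :
    ∃ T : (Fin n → ℝ) → Fin n → ℝ, Measurable T ∧ ∀ x ∈ W, T x ≤ x ∧ T x ∈ swBoundary W := by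
  obtain ⟨T, hT, hTx⟩ := exists_measurable_lower_coordinates hW hW0 (List.finRange n)
  refine ⟨T, hT, fun x hx => ?_⟩
  obtain ⟨hle, ⟨y, hy, hyx⟩, hmin⟩ := hTx x (subset_upperClosure hx)
  have heq : ∀ z ∈ W, z ≤ T x → z = T x := fun z hz hzx =>
    le_antisymm hzx fun i => hmin i (List.mem_finRange i) z hz hzx
  exact ⟨hle, heq y hy hyx ▸ hy, heq⟩

theorem measurableSet_swBoundary (hW : IsClosed W) (hW0 : ∀ x ∈ W, 0 ≤ x) :
    MeasurableSet (swBoundary W) := by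
  obtain ⟨T, hT, hTx⟩ := exists_measurable_retraction_swBoundary hW hW0
  convert hW.measurableSet.inter (measurableSet_eq_fun hT measurable_id) using 1
  ext x
  constructor
  · exact fun hx => ⟨hx.1, hx.2 _ (hTx x hx.1).2.1 (hTx x hx.1).1⟩
  · rintro ⟨hx, hxT⟩
    have hxT : T x = x := hxT
    exact hxT ▸ (hTx x hx).2

end Retraction

/-- **Mass-retraction result.** For `f ∈ 𝓑_c^n`, a nonempty closed `V ⊆ ℝ^n`, and
`X ∈ 𝒯^d(f)`, there is a random vector `Y ∈ 𝒯^d(f)` (given by its law, a probability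
measure `ν` on `ℝ^n` satisfying the tail bounds) with
`P(X ∈ V) = P(Y ∈ ∂_SW Q(V))`. -/
theorem exists_retracted_random_vector
    (n : ℕ) (hn : 1 ≤ n)
    (f : Fin n → ℝ → ℝ)
    (hf_cont : ∀ i, ContinuousOn (f i) (Ici 0))
    (hf_anti : ∀ i, StrictAntiOn (f i) (Ici 0))
    (hf_pos : ∀ i t, 0 ≤ t → 0 < f i t)
    (hf_one : ∀ i, 1 ≤ f i 0)
    (hf_lim : ∀ i, Tendsto (f i) atTop (nhds 0))
    (V : Set (Fin n → ℝ)) (hV_ne : V.Nonempty) (hV_closed : IsClosed V)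
    {Ω : Type*} [MeasurableSpace Ω] (μ : Measure Ω) [IsProbabilityMeasure μ]
    (X : Ω → Fin n → ℝ) (hX : Measurable X)
    (hTail : ∀ (i : Fin n) (t : ℝ), 0 ≤ t → μ {ω | t ≤ |X ω i|} ≤ ENNReal.ofReal (f i t)) :
    ∃ ν : Measure (Fin n → ℝ), IsProbabilityMeasure ν ∧
      (∀ (i : Fin n) (t : ℝ), 0 ≤ t → ν {x | t ≤ |x i|} ≤ ENNReal.ofReal (f i t)) ∧
      μ (X ⁻¹' V) = ν (swBoundary (Qmap '' V)) := by
  classical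
  have hW : IsClosed (Qmap '' V) := isClosedMap_Qmap V hV_closed
  have hW0 : ∀ x ∈ Qmap '' V, 0 ≤ x := by
    rintro _ ⟨x, -, rfl⟩
    exact Qmap_nonneg x
  obtain ⟨T, hT, hTx⟩ := exists_measurable_retraction_swBoundary hW hW0
  let R : (Fin n → ℝ) → Fin n → ℝ := fun x => if x ∈ V then T (Qmap x) else -Qmap x
  have hR : Measurable R :=
    Measurable.ite hV_closed.measurableSet (hT.comp measurable_Qmap) measurable_Qmap.neg
  have hR_abs : ∀ x i, |R x i| ≤ |x i| := by
    intro x i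
    by_cases hx : x ∈ V
    · obtain ⟨hle, hmem⟩ := hTx _ (mem_image_of_mem Qmap hx)
      simp only [R, if_pos hx]
      rw [abs_of_nonneg (hW0 _ hmem.1 i)]
      exact hle i
    · simp [R, hx, Qmap]
  have hR_iff : ∀ x, R x ∈ swBoundary (Qmap '' V) ↔ x ∈ V := by
    intro x
    by_cases hx : x ∈ V
    · simpa [R, hx] using (hTx _ (mem_image_of_mem Qmap hx)).2
    · simp only [R, if_neg hx, hx, iff_false]
      rintro ⟨⟨z, hz, hzx⟩, -⟩
      have hzero : ∀ i, z i = 0 ∧ x i = 0 := by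
        intro i
        have h : |z i| = -|x i| := congrFun hzx i
        have h1 := abs_nonneg (z i)
        have h2 := abs_nonneg (x i)
        exact ⟨abs_eq_zero.1 (by linarith), abs_eq_zero.1 (by linarith)⟩
      exact hx ((funext fun i => (hzero i).1.trans (hzero i).2.symm : z = x) ▸ hz)
  refine ⟨μ.map (R ∘ X), Measure.isProbabilityMeasure_map (hR.comp hX).aemeasurable, ?_, ?_⟩
  · intro i t ht
    rw [Measure.map_apply (hR.comp hX)
      (measurableSet_le measurable_const (measurable_pi_apply i).abs)]
    exact (measure_mono fun ω hω => le_trans (b := |R (X ω) i|) hω (hR_abs _ i)).trans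
      (hTail i t ht)
  · rw [Measure.map_apply (hR.comp hX) (measurableSet_swBoundary hW hW0)]
    congr 1
    ext ω
    exact (hR_iff (X ω)).symm
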